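/- Theorem 1, (1)⇔(3): A dataset {p^N}_{N∈𝒩} is consistent with the general linear-in-means model (GLM) if and only if it satisfies no incentive compatible money pump, i.e. for every agent i ∈ 𝒜 there is no family (b^N)_{N∈𝒩_i} of vectors in ℝ^X such that (a) Σ_{N∈𝒩_i} b^N has all coordinates strictly negative, (b) b^N · p_i^N > 0 for every N ∈ 𝒩_i, and (c) b^N · (p_i^N − p_j^N) ≥ 0 for every N ∈ 𝒩_i and every j ∈ N∖{i}. -/

import Mathlib

open Finset
open scoped Classical

noncomputable section

/-- The simplex Δ(X) of probability vectors on a finite set X. -/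
def simplex (X : Type*) [Fintype X] : Set (X → ℝ) :=
  {v | (∀ x, 0 ≤ v x) ∧ (∑ x, v x) = 1}

/-- Consistency with the general linear-in-means model (GLM). -/
def GLMConsistent {X A : Type*} [Fintype X] [DecidableEq A]
    (𝒩 : Finset (Finset A)) (p : Finset A → A → X → ℝ) : Prop :=
  ∃ v : A → X → ℝ, (∀ i, v i ∈ simplex X) ∧
    ∀ N ∈ 𝒩, ∀ i ∈ N, ∃ π : A → ℝ,
      (∀ j ∈ N, 0 ≤ π j) ∧ 0 < π i ∧ (∑ j ∈ N, π j) = 1 ∧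
      p N i = π i • v i + ∑ j ∈ N.erase i, π j • p N j

/-- Dot product on ℝ^X. -/
def dot {X : Type*} [Fintype X] (a b : X → ℝ) : ℝ := ∑ x, a x * b x

theorem farkas_aux {W ι : Type*} [AddCommGroup W] [Module ℝ W] (s : Finset ι) :
    ∀ (f : ι → W →ₗ[ℝ] ℝ) (g : W →ₗ[ℝ] ℝ),
      (∀ x, (∀ i ∈ s, f i x ≤ 0) → g x ≤ 0) →
      ∃ l : ι → ℝ, (∀ i ∈ s, 0 ≤ l i) ∧ ∀ x, g x = ∑ i ∈ s, l i * f i x := by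
  induction s using Finset.induction_on with
  | empty =>
    intro f g h
    refine ⟨0, by simp, fun x => ?_⟩
    have h1 := h x (by simp)
    have h2 := h (-x) (by simp)
    simp at h2 ⊢
    linarith
  | insert a s ha ih =>
    intro f g h
    by_cases hc : ∀ x, (∀ i ∈ s, f i x ≤ 0) → g x ≤ 0
    · obtain ⟨l, hl, hg⟩ := ih f g hc
      refine ⟨fun i => if i = a then 0 else l i, ?_, ?_⟩
      · intro i hi
        by_cases hia : i = a
        · simp [hia]
        · simpa [hia] using hl i (Finset.mem_of_mem_insert_of_ne hi hia)
      · intro x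
        rw [Finset.sum_insert ha, hg x]
        simp only [if_true, zero_mul, zero_add]
        refine Finset.sum_congr rfl fun i hi => ?_
        have : i ≠ a := fun e => ha (e ▸ hi)
        simp [this]
    · push Not at hc
      obtain ⟨y, hy, hgy⟩ := hc
      have hB : 0 < f a y := by
        by_contra hB
        have := h y (by
          intro i hi
          rcases Finset.mem_insert.1 hi with rfl | hi
          · linarith
          · exact hy i hi)
        linarith
      set c := (f a y)⁻¹ with hcdef
      have hcpos : 0 < c := inv_pos.2 hB
      have hcy : c * f a y = 1 := inv_mul_cancel₀ hB.ne'
      obtain ⟨l, hl, hg⟩ := ih (fun i => f i - (c * f i y) • f a) (g - (c * g y) • f a) (by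
        intro x hx
        have := h (x - (c * f a x) • y) (by
          intro i hi
          rcases Finset.mem_insert.1 hi with rfl | hi
          · simp only [map_sub, map_smul, smul_eq_mul]
            apply le_of_eq
            linear_combination (-f i x) * hcy
          · have := hx i hi
            simp only [LinearMap.sub_apply, LinearMap.smul_apply, smul_eq_mul] at this
            simp only [map_sub, map_smul, smul_eq_mul]
            nlinarith)
        simp only [map_sub, map_smul, smul_eq_mul] at this
        simp only [LinearMap.sub_apply, LinearMap.smul_apply, smul_eq_mul]
        nlinarith)
      refine ⟨fun i => if i = a then c * g y - ∑ j ∈ s, l j * (c * f j y) else l i, ?_, ?_⟩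
      · intro i hi
        by_cases hia : i = a
        · have : ∑ j ∈ s, l j * (c * f j y) ≤ 0 := Finset.sum_nonpos fun j hj =>
            mul_nonpos_of_nonneg_of_nonpos (hl j hj)
              (mul_nonpos_of_nonneg_of_nonpos hcpos.le (hy j hj))
          have h2 : 0 < c * g y := mul_pos hcpos hgy
          simp only [hia, if_true]
          linarith
        · simpa [hia] using hl i (Finset.mem_of_mem_insert_of_ne hi hia)
      · intro x
        have hx := hg x
        simp only [LinearMap.sub_apply, LinearMap.smul_apply, smul_eq_mul, mul_sub,
          Finset.sum_sub_distrib] at hx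
        rw [Finset.sum_insert ha]
        have e : ∑ i ∈ s, (if i = a then c * g y - ∑ j ∈ s, l j * (c * f j y) else l i) * f i x
            = ∑ i ∈ s, l i * f i x := by
          refine Finset.sum_congr rfl fun i hi => ?_
          have : i ≠ a := fun e => ha (e ▸ hi)
          simp [this]
        rw [e]
        simp only [if_true, sub_mul, Finset.sum_mul]
        simp only [mul_assoc] at hx ⊢
        linarith

/-- dot product against a coordinate block, as a linear functional. -/
def blockDot {X A : Type*} [Fintype X] (N : Finset A) (q : X → ℝ) :
    (Finset A → X → ℝ) →ₗ[ℝ] ℝ where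
  toFun b := dot (b N) q
  map_add' b c := by simp [dot, add_mul, Finset.sum_add_distrib]
  map_smul' r b := by simp [dot, mul_assoc, Finset.mul_sum]

theorem blockDot_apply {X A : Type*} [Fintype X] (N : Finset A) (q : X → ℝ)
    (b : Finset A → X → ℝ) : blockDot N q b = dot (b N) q := rfl

theorem dot_single' {X : Type*} [Fintype X] (x : X) (q : X → ℝ) :
    dot (Pi.single x 1) q = q x := by
  simp [dot, Pi.single_apply]

theorem dot_sub' {X : Type*} [Fintype X] (b q r : X → ℝ) :
    dot b (q - r) = dot b q - dot b r := by
  simp [dot, mul_sub, Finset.sum_sub_distrib]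

theorem dot_addc {X : Type*} [Fintype X] (b q : X → ℝ) (c : ℝ) (hq : q ∈ simplex X) :
    dot (fun x => b x + c) q = dot b q + c := by
  simp [dot, add_mul, Finset.sum_add_distrib, ← Finset.mul_sum, hq.2]

theorem key {X A : Type*} [Fintype X] [DecidableEq A] (F : Finset (Finset A))
    (hF : F.Nonempty) (p : Finset A → A → X → ℝ) (i : A)
    (hi : ∀ N ∈ F, i ∈ N) (hp : ∀ N ∈ F, ∀ j ∈ N, p N j ∈ simplex X)
    (hno : ¬ ∃ b : Finset A → X → ℝ,
        (∀ x : X, (∑ N ∈ F, b N x) < 0) ∧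
        (∀ N ∈ F, 0 < dot (b N) (p N i)) ∧
        (∀ N ∈ F, ∀ j ∈ N.erase i, 0 ≤ dot (b N) (p N i - p N j))) :
    ∃ (v : X → ℝ) (l : Finset A → A → ℝ), v ∈ simplex X ∧
      (∀ N ∈ F, ∀ j ∈ N.erase i, 0 ≤ l N j) ∧
      ∀ N ∈ F, v = p N i + ∑ j ∈ N.erase i, l N j • (p N i - p N j) := by
  obtain ⟨l, hl, hg⟩ := farkas_aux
    (W := Finset A → X → ℝ) (ι := X ⊕ (Σ _ : Finset A, A))
    ((Finset.univ : Finset X).disjSum (F.sigma fun N => N.erase i))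
    (Sum.elim (fun x => ∑ N ∈ F, blockDot N (Pi.single x 1))
      (fun t => - blockDot t.1 (p t.1 i - p t.1 t.2)))
    (∑ N ∈ F, blockDot N (p N i)) (by
      intro b hb
      by_contra hpos
      push Not at hpos
      apply hno
      have hb1 : ∀ x, ∑ N ∈ F, b N x ≤ 0 := by
        intro x
        have := hb (Sum.inl x) (by simp)
        simpa [blockDot_apply, dot, Pi.single_apply] using this
      have hb2 : ∀ N ∈ F, ∀ j ∈ N.erase i, 0 ≤ dot (b N) (p N i - p N j) := by
        intro N hN j hj
        have := hb (Sum.inr ⟨N, j⟩) (by simp at hj ⊢; exact ⟨hN, hj⟩)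
        simpa [blockDot_apply] using this
      simp only [LinearMap.sum_apply, blockDot_apply] at hpos
      set S := ∑ N ∈ F, dot (b N) (p N i) with hS
      have hn : (0:ℝ) < F.card := by exact_mod_cast hF.card_pos
      set e := S / (2 * F.card) with he
      have hepos : 0 < e := by positivity
      have hne : F.card * e = S / 2 := by rw [he]; field_simp
      refine ⟨fun N x => b N x + (e - dot (b N) (p N i)), ?_, ?_, ?_⟩
      · intro x
        rw [Finset.sum_add_distrib, Finset.sum_sub_distrib, Finset.sum_const, nsmul_eq_mul, hne]
        have := hb1 x
        linarith
      · intro N hN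
        rw [dot_addc _ _ _ (hp N hN i (hi N hN))]
        linarith
      · intro N hN j hj
        rw [dot_sub', dot_addc _ _ _ (hp N hN i (hi N hN)),
          dot_addc _ _ _ (hp N hN j (Finset.mem_of_mem_erase hj))]
        have := hb2 N hN j hj
        rw [dot_sub'] at this
        linarith)
  have heq : ∀ N ∈ F, (fun x => l (Sum.inl x))
      = p N i + ∑ j ∈ N.erase i, l (Sum.inr ⟨N, j⟩) • (p N i - p N j) := by
    intro N hN
    funext x
    have h := hg (Pi.single N (Pi.single x 1))
    simp only [Finset.sum_disjSum, Finset.sum_sigma, Sum.elim_inl, Sum.elim_inr,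
      LinearMap.sum_apply, LinearMap.neg_apply, blockDot_apply] at h
    have d : ∀ (M : Finset A) (q : X → ℝ),
        dot ((Pi.single N (Pi.single x 1) : Finset A → X → ℝ) M) q
          = if M = N then q x else 0 := by
      intro M q
      by_cases hM : M = N
      · subst hM; simp [dot_single']
      · simp [hM, dot]
    simp only [d] at h
    simp only [Finset.sum_ite_eq', hN, if_true] at h
    have e1 : ∑ y, l (Sum.inl y) * (Pi.single y (1:ℝ) : X → ℝ) x = l (Sum.inl x) := by
      simp [Pi.single_apply]
    have e2 : ∑ M ∈ F, ∑ j ∈ M.erase i,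
        l (Sum.inr ⟨M, j⟩) * -(if M = N then (p M i - p M j) x else 0)
        = - ∑ j ∈ N.erase i, l (Sum.inr ⟨N, j⟩) * (p N i - p N j) x := by
      rw [Finset.sum_eq_single_of_mem N hN]
      · simp only [if_true, mul_neg, Finset.sum_neg_distrib]
      · intro M _ hM
        simp [hM]
    rw [e1, e2] at h
    simp only [Pi.add_apply, Finset.sum_apply, Pi.smul_apply, smul_eq_mul]
    linarith
  refine ⟨fun x => l (Sum.inl x), fun N j => l (Sum.inr ⟨N, j⟩), ⟨?_, ?_⟩, ?_, heq⟩
  · intro x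
    exact hl _ (by simp)
  · obtain ⟨N, hN⟩ := hF
    rw [heq N hN]
    simp only [Pi.add_apply, Finset.sum_apply, Pi.smul_apply, smul_eq_mul, Pi.sub_apply,
      Finset.sum_add_distrib]
    rw [Finset.sum_comm, (hp N hN i (hi N hN)).2, add_eq_left]
    refine Finset.sum_eq_zero fun j hj => ?_
    rw [← Finset.mul_sum, Finset.sum_sub_distrib, (hp N hN i (hi N hN)).2,
      (hp N hN j (Finset.mem_of_mem_erase hj)).2]
    simp
  · intro N hN j hj
    exact hl _ (by simp at hj ⊢; exact ⟨hN, hj⟩)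

/-- Theorem 1, (1) ⇔ (3): consistency with GLM is equivalent to the absence, for every
agent i, of a strictly feasible, individually rational, and incentive compatible bet. -/
theorem glm_iff_no_incentive_compatible_money_pump
    {X A : Type*} [Fintype X] [Fintype A] [DecidableEq A]
    (hX : 2 ≤ Fintype.card X) (hA : 2 ≤ Fintype.card A)
    (𝒩 : Finset (Finset A)) (h𝒩 : 𝒩.Nonempty) (h𝒩' : ∀ N ∈ 𝒩, N.Nonempty)
    (p : Finset A → A → X → ℝ) (hp : ∀ N ∈ 𝒩, ∀ i ∈ N, p N i ∈ simplex X) :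
    GLMConsistent 𝒩 p ↔
      ∀ i : A, ¬ ∃ b : Finset A → X → ℝ,
        (∀ x : X, (∑ N ∈ 𝒩.filter (fun N => i ∈ N), b N x) < 0) ∧
        (∀ N ∈ 𝒩.filter (fun N => i ∈ N), 0 < dot (b N) (p N i)) ∧
        (∀ N ∈ 𝒩.filter (fun N => i ∈ N), ∀ j ∈ N.erase i,
          0 ≤ dot (b N) (p N i - p N j)) := by
  have hXn : Nonempty X := Fintype.card_pos_iff.1 (by omega)
  constructor
  · rintro ⟨v, hv, h⟩ i ⟨b, hb1, hb2, hb3⟩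
    have hge : ∀ N ∈ 𝒩.filter (fun N => i ∈ N), 0 < dot (b N) (v i) := by
      intro N hN
      have hN' := Finset.mem_filter.1 hN
      obtain ⟨π, h0, hpos, hsum, heq⟩ := h N hN'.1 i hN'.2
      have e : dot (b N) (p N i)
          = π i * dot (b N) (v i) + ∑ j ∈ N.erase i, π j * dot (b N) (p N j) := by
        have e0 : dot (b N) (p N i)
          = dot (b N) (π i • v i + ∑ j ∈ N.erase i, π j • p N j) := by rw [← heq]
        rw [e0]
        simp only [dot, Pi.add_apply, Finset.sum_apply, Pi.smul_apply, smul_eq_mul, mul_add,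
          Finset.sum_add_distrib, Finset.mul_sum]
        rw [Finset.sum_comm (s := Finset.univ)]
        congr 1
        · exact Finset.sum_congr rfl fun x _ => by ring
        · exact Finset.sum_congr rfl fun j _ => Finset.sum_congr rfl fun x _ => by ring
      have le : ∑ j ∈ N.erase i, π j * dot (b N) (p N j)
          ≤ ∑ j ∈ N.erase i, π j * dot (b N) (p N i) := by
        refine Finset.sum_le_sum fun j hj => ?_
        have := hb3 N hN j hj
        rw [dot_sub'] at this
        exact mul_le_mul_of_nonneg_left (by linarith) (h0 j (Finset.mem_of_mem_erase hj))
      rw [← Finset.sum_mul] at le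
      have hs := Finset.add_sum_erase N π hN'.2
      have hs' : ∑ j ∈ N.erase i, π j = 1 - π i := by linarith
      rw [hs'] at le
      have := hb2 N hN
      have h3 : 0 < π i * dot (b N) (v i) := by
        have := mul_pos hpos this
        linarith
      exact (mul_pos_iff_of_pos_left hpos).1 h3
    have hsum : 0 ≤ ∑ N ∈ 𝒩.filter (fun N => i ∈ N), dot (b N) (v i) :=
      Finset.sum_nonneg fun N hN => (hge N hN).le
    have e : ∑ N ∈ 𝒩.filter (fun N => i ∈ N), dot (b N) (v i)
        = ∑ x, (∑ N ∈ 𝒩.filter (fun N => i ∈ N), b N x) * v i x := by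
      simp only [dot, Finset.sum_mul]
      rw [Finset.sum_comm]
    rw [e] at hsum
    have hneg : ∑ x, (∑ N ∈ 𝒩.filter (fun N => i ∈ N), b N x) * v i x < 0 := by
      have hex : ∃ x, 0 < v i x := by
        by_contra hc
        push Not at hc
        have := Finset.sum_nonpos (s := Finset.univ) fun x _ => hc x
        have := (hv i).2
        linarith
      obtain ⟨x, hx⟩ := hex
      exact Finset.sum_neg' (fun y _ => mul_nonpos_of_nonpos_of_nonneg (hb1 y).le ((hv i).1 y))
        ⟨x, Finset.mem_univ x, mul_neg_of_neg_of_pos (hb1 x) hx⟩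
    linarith
  · intro h
    have hk : ∀ i : A, ∃ (v : X → ℝ) (l : Finset A → A → ℝ), v ∈ simplex X ∧
        (∀ N ∈ 𝒩.filter (fun N => i ∈ N), ∀ j ∈ N.erase i, 0 ≤ l N j) ∧
        ∀ N ∈ 𝒩.filter (fun N => i ∈ N),
          v = p N i + ∑ j ∈ N.erase i, l N j • (p N i - p N j) := by
      intro i
      rcases (𝒩.filter (fun N => i ∈ N)).eq_empty_or_nonempty with hE | hE
      · obtain ⟨x0⟩ := hXn
        refine ⟨Pi.single x0 1, 0, ⟨fun x => ?_, by simp⟩, by simp, by simp [hE]⟩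
        rw [Pi.single_apply]
        split_ifs <;> norm_num
      · exact key _ hE p i (fun N hN => (Finset.mem_filter.1 hN).2)
          (fun N hN => hp N (Finset.mem_filter.1 hN).1) (h i)
    choose v l hv hl heq using hk
    refine ⟨v, hv, fun N hN i hi => ?_⟩
    have hm : N ∈ 𝒩.filter (fun N => i ∈ N) := Finset.mem_filter.2 ⟨hN, hi⟩
    set L := ∑ j ∈ N.erase i, l i N j with hL
    have hL0 : 0 ≤ L := Finset.sum_nonneg (hl i N hm)
    have hc : 0 < (1 + L)⁻¹ := by positivity
    have hc1 : (1 + L)⁻¹ * (1 + L) = 1 := inv_mul_cancel₀ (by positivity)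
    have e : ∀ j ∈ N.erase i, (if j = i then (1 + L)⁻¹ else (1 + L)⁻¹ * l i N j)
        = (1 + L)⁻¹ * l i N j := fun j hj => by simp [Finset.ne_of_mem_erase hj]
    refine ⟨fun j => if j = i then (1 + L)⁻¹ else (1 + L)⁻¹ * l i N j, ?_, ?_, ?_, ?_⟩
    · intro j hj
      by_cases hji : j = i
      · simp [hji, hc.le]
      · simp only [hji, if_false]
        exact mul_nonneg hc.le (hl i N hm j (Finset.mem_erase.2 ⟨hji, hj⟩))
    · simpa using hc
    · rw [← Finset.add_sum_erase _ _ hi, Finset.sum_congr rfl e, ← Finset.mul_sum]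
      simp only [if_true]
      rw [← hL]
      linarith
    · funext x
      have hx := congrFun (heq i N hm) x
      simp only [Pi.add_apply, Finset.sum_apply, Pi.smul_apply, smul_eq_mul, Pi.sub_apply, mul_sub,
        Finset.sum_sub_distrib, ← Finset.sum_mul] at hx
      rw [← hL] at hx
      simp only [Pi.add_apply, Finset.sum_apply, Pi.smul_apply, smul_eq_mul, if_true]
      have e2 : ∑ j ∈ N.erase i, (if j = i then (1 + L)⁻¹ else (1 + L)⁻¹ * l i N j) * p N j x
          = (1 + L)⁻¹ * ∑ j ∈ N.erase i, l i N j * p N j x := by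
        rw [Finset.mul_sum]
        exact Finset.sum_congr rfl fun j hj => by rw [e j hj, mul_assoc]
      rw [e2, hx]
      linear_combination (-p N i x) * hc1
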